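/- arXiv:2112.14724 — 2 statements merged into one kernel-verified Lean document; each statement's English description precedes it below -/
import Mathlib

section
/- Let X be an integrable real random variable with E[X] = 0 and X ≥ −1 almost surely. Then for every λ ≥ 0, E[e^{λX}] ≥ e^{𝔣(λ) Var(X)}, where 𝔣(λ) = e^{−λ} − 1 + λ. -/
open MeasureTheory Filter ProbabilityTheory Topology

noncomputable section

/-- The special function `𝔣(λ) = e^{−λ} − 1 + λ`. -/
def specialF (l : ℝ) : ℝ := Real.exp (-l) - 1 + l

/-- Monotonicity of `t ↦ (exp t - 1 - t) / t ^ 2`, in division-free form. -/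
theorem sq_mul_exp_sub_one_sub_le {u t : ℝ} (h : u ≤ t) :
    t ^ 2 * (Real.exp u - 1 - u) ≤ u ^ 2 * (Real.exp t - 1 - t) := by
  let F : ℝ → ℝ → ℝ := fun v r ↦ Real.exp (r * v) * (1 + (1 - r) * v)
  have hF (v r : ℝ) : HasDerivAt (F v) ((1 - r) * v ^ 2 * Real.exp (r * v)) r := by
    have h₁ : HasDerivAt (fun r : ℝ ↦ Real.exp (r * v)) (Real.exp (r * v) * (1 * v)) r :=
      ((hasDerivAt_id r).mul_const v).exp
    have h₂ : HasDerivAt (fun r : ℝ ↦ 1 + (1 - r) * v) (-1 * v) r :=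
      (((hasDerivAt_id r).const_sub 1).mul_const v).const_add 1
    exact (h₁.mul h₂).congr_deriv (by ring)
  have hG (r : ℝ) := ((hF t r).const_mul (u ^ 2)).sub ((hF u r).const_mul (t ^ 2))
  have hmono := monotoneOn_of_deriv_nonneg (convex_Icc (0 : ℝ) 1)
    (fun r _ ↦ (hG r).continuousAt.continuousWithinAt)
    (fun r _ ↦ (hG r).differentiableAt.differentiableWithinAt) (fun r hr ↦ by
      rw [interior_Icc] at hr
      rw [(hG r).deriv]
      have hexp : Real.exp (r * u) ≤ Real.exp (r * t) :=
        Real.exp_le_exp.mpr (mul_le_mul_of_nonneg_left h hr.1.le)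
      have := mul_nonneg (mul_nonneg (sub_nonneg.mpr hr.2.le) (sq_nonneg (u * t)))
        (sub_nonneg.mpr hexp)
      linarith)
  have := hmono (Set.left_mem_Icc.mpr zero_le_one) (Set.right_mem_Icc.mpr zero_le_one) zero_le_one
  simp only [F, Pi.sub_apply, zero_mul, one_mul, Real.exp_zero, sub_zero, sub_self, add_zero,
    mul_one] at this
  linarith

/-- The quadratic agreeing with `exp (l * x)` at `-1` and tangent to it at `v` is a minorant on
`[-1, ∞)`. -/
theorem quadratic_le_exp_mul {l v x : ℝ} (hl : 0 ≤ l) (hv : 0 ≤ v) (hx : -1 ≤ x) :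
    Real.exp (l * v) * (1 + l * (x - v) +
      (Real.exp (-(l * (1 + v))) - 1 + l * (1 + v)) / (1 + v) ^ 2 * (x - v) ^ 2) ≤
      Real.exp (l * x) := by
  rcases hl.eq_or_lt with rfl | hl
  · simp
  have h := sq_mul_exp_sub_one_sub_le (u := -(l * (1 + v))) (t := l * (x - v)) (by nlinarith)
  have hexp : Real.exp (l * x) = Real.exp (l * v) * Real.exp (l * (x - v)) := by
    rw [← Real.exp_add]; ring_nf
  rw [hexp]
  refine mul_le_mul_of_nonneg_left ?_ (Real.exp_pos _).le
  have hdiv : (Real.exp (-(l * (1 + v))) - 1 + l * (1 + v)) / (1 + v) ^ 2 * (x - v) ^ 2 ≤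
      Real.exp (l * (x - v)) - 1 - l * (x - v) := by
    rw [div_mul_eq_mul_div, div_le_iff₀ (by positivity)]
    refine le_of_mul_le_mul_left ?_ (pow_pos hl 2)
    linarith
  linarith

/-- The exponential bound for the centred law on `{-1, v}`. -/
theorem exp_specialF_mul_le {l v : ℝ} (hl : 0 ≤ l) (hv : 0 ≤ v) :
    Real.exp (specialF l * v) ≤ (Real.exp (l * v) + v * Real.exp (-l)) / (1 + v) := by
  have hd (r : ℝ) : HasDerivAt
      (fun r : ℝ ↦ (Real.exp (r * v) + v * Real.exp (-r)) * Real.exp (-(specialF r * v)))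
      ((Real.exp (r * v) * v + v * (Real.exp (-r) * -1)) * Real.exp (-(specialF r * v)) +
        (Real.exp (r * v) + v * Real.exp (-r)) *
          (Real.exp (-(specialF r * v)) * -((Real.exp (-r) * -1 + 1) * v))) r := by
    have h₁ : HasDerivAt (fun r : ℝ ↦ Real.exp (r * v)) (Real.exp (r * v) * v) r := by
      simpa using ((hasDerivAt_id r).mul_const v).exp
    have h₂ : HasDerivAt (fun r : ℝ ↦ Real.exp (-r)) (Real.exp (-r) * -1) r :=
      (hasDerivAt_neg r).exp
    have h₃ : HasDerivAt specialF (Real.exp (-r) * -1 + 1) r :=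
      (h₂.sub_const 1).add (hasDerivAt_id r)
    exact (h₁.add (h₂.const_mul v)).mul (h₃.mul_const v).neg.exp
  have hmono := monotoneOn_of_deriv_nonneg (convex_Ici (0 : ℝ))
    (fun r _ ↦ (hd r).continuousAt.continuousWithinAt)
    (fun r _ ↦ (hd r).differentiableAt.differentiableWithinAt) (fun r _ ↦ by
      rw [(hd r).deriv]
      have h₁ := Real.add_one_le_exp (r * v)
      have h₂ := mul_le_mul_of_nonneg_left (Real.add_one_le_exp (-r)) hv
      have h₃ : 0 ≤ Real.exp (r * v) - 1 - v + v * Real.exp (-r) := by linarith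
      have := mul_nonneg (by positivity : 0 ≤ v * Real.exp (-r) * Real.exp (-(specialF r * v))) h₃
      linarith)
  have := hmono (Set.mem_Ici.mpr le_rfl) (Set.mem_Ici.mpr hl) hl
  simp only [specialF, zero_mul, neg_zero, Real.exp_zero, sub_self, add_zero, mul_one] at this
  rw [Real.exp_neg (_ * v), ← div_eq_mul_inv, le_div_iff₀ (Real.exp_pos _)] at this
  rw [le_div_iff₀ (by positivity), mul_comm]
  exact this

/-- Positive parts can only increase an integral. -/
theorem ofReal_integral_le_lintegral_ofReal {Ω : Type*} [MeasurableSpace Ω] {μ : Measure Ω}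
    {g : Ω → ℝ} (hg : Integrable g μ) :
    ENNReal.ofReal (∫ ω, g ω ∂μ) ≤ ∫⁻ ω, ENNReal.ofReal (g ω) ∂μ := by
  rw [integral_eq_lintegral_pos_part_sub_lintegral_neg_part hg]
  exact (ENNReal.ofReal_le_ofReal (sub_le_self _ ENNReal.toReal_nonneg)).trans
    ENNReal.ofReal_toReal_le

/-- Freedman's exponential lower bound: if `E[X] = 0` and `X ≥ −1` a.s., then for every
`λ ≥ 0`, `E[e^{λX}] ≥ e^{𝔣(λ) Var(X)}`. -/
theorem stmt3
    {Ω : Type*} [MeasurableSpace Ω] (Pr : Measure Ω) [IsProbabilityMeasure Pr]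
    (X : Ω → ℝ) (hint : Integrable X Pr)
    (hmean : ∫ ω, X ω ∂Pr = 0)
    (hlb : ∀ᵐ ω ∂Pr, -1 ≤ X ω) :
    ∀ l : ℝ, 0 ≤ l →
      ENNReal.ofReal (Real.exp (specialF l * variance X Pr)) ≤
        ∫⁻ ω, ENNReal.ofReal (Real.exp (l * X ω)) ∂Pr := by
  intro l hl
  suffices ∃ g : Ω → ℝ, Integrable g Pr ∧ (∀ᵐ ω ∂Pr, g ω ≤ Real.exp (l * X ω)) ∧
      Real.exp (specialF l * variance X Pr) ≤ ∫ ω, g ω ∂Pr by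
    obtain ⟨g, hg, hle, hbound⟩ := this
    refine (ENNReal.ofReal_le_ofReal hbound).trans
      ((ofReal_integral_le_lintegral_ofReal hg).trans (lintegral_mono_ae ?_))
    filter_upwards [hle] with ω hω using ENNReal.ofReal_le_ofReal hω
  by_cases hX : MemLp X 2 Pr
  · have hvar : variance X Pr = ∫ ω, X ω ^ 2 ∂Pr :=
      variance_of_integral_eq_zero hint.aemeasurable hmean
    have hv : 0 ≤ variance X Pr := variance_nonneg X Pr
    set v := variance X Pr
    set c := (Real.exp (-(l * (1 + v))) - 1 + l * (1 + v)) / (1 + v) ^ 2 with hc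
    have hexpand : (fun ω ↦ Real.exp (l * v) * (1 + l * (X ω - v) + c * (X ω - v) ^ 2)) =
        fun ω ↦ Real.exp (l * v) * (1 - l * v + c * v ^ 2) +
          (Real.exp (l * v) * (l - 2 * c * v) * X ω + Real.exp (l * v) * c * X ω ^ 2) := by
      ext ω; ring
    have hlin := hint.const_mul (Real.exp (l * v) * (l - 2 * c * v))
    have hquad := hX.integrable_sq.const_mul (Real.exp (l * v) * c)
    have hsum : Integrable (fun ω ↦ Real.exp (l * v) * (l - 2 * c * v) * X ω +
        Real.exp (l * v) * c * X ω ^ 2) Pr := hlin.add hquad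
    refine ⟨_, ?_, hlb.mono fun ω hω ↦ quadratic_le_exp_mul hl hv hω, ?_⟩
    · rw [hexpand]
      exact (integrable_const _).add hsum
    · rw [hexpand, integral_add (integrable_const _) hsum, integral_add hlin hquad,
        integral_const, integral_const_mul, integral_const_mul, hmean, ← hvar]
      refine (exp_specialF_mul_le hl hv).trans_eq ?_
      have hexp : Real.exp (-l) = Real.exp (l * v) * Real.exp (-(l * (1 + v))) := by
        rw [← Real.exp_add]; ring_nf
      rw [hexp, hc]
      simp only [probReal_univ, one_smul]
      field_simp
      ring
  · have hvar : variance X Pr = 0 :=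
      variance_of_not_memLp hint.aestronglyMeasurable hX
    refine ⟨fun ω ↦ l * X ω + 1, (hint.const_mul l).add (integrable_const 1),
      ae_of_all _ fun ω ↦ Real.add_one_le_exp _, ?_⟩
    rw [integral_add (hint.const_mul l) (integrable_const 1), integral_const_mul, hmean, hvar]
    simp

end
end

section
/- Let (Y_n)_{n≥1} be real random variables and K > 0 a constant such that Y_n ≥ −nK almost surely for every n. Suppose that for every ε > 0, limsup_{n→∞} (1/n) log P(Y_n ≤ −nε) < 0. Then limsup_{λ→0⁺} (1/λ) limsup_{n→∞} (1/n) log E[exp(−λ Y_n)] ≤ 0. -/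
open MeasureTheory Filter ProbabilityTheory Topology

noncomputable section

theorem lintegral_le_const_add_mul_measure {Ω : Type*} [MeasurableSpace Ω] (μ : Measure Ω)
    [IsProbabilityMeasure μ] {f : Ω → ENNReal} {A : Set Ω} {a b : ENNReal}
    (hA : ∀ ω, ω ∉ A → f ω ≤ a) (hb : ∀ᵐ ω ∂μ, f ω ≤ b) :
    ∫⁻ ω, f ω ∂μ ≤ a + b * μ A := by
  calc ∫⁻ ω, f ω ∂μ
      ≤ ∫⁻ ω, (a + (toMeasurable μ A).indicator (fun _ => b) ω) ∂μ := by
        refine lintegral_mono_ae ?_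
        filter_upwards [hb] with ω hω
        by_cases h : ω ∈ A
        · rw [Set.indicator_of_mem (subset_toMeasurable μ A h)]
          exact hω.trans le_add_self
        · exact (hA ω h).trans le_self_add
    _ = a + b * μ A := by
        rw [lintegral_add_left measurable_const,
          lintegral_indicator_const (measurableSet_toMeasurable μ A), measure_toMeasurable]
        simp

theorem ENNReal.log_ofReal_exp (x : ℝ) : ENNReal.log (ENNReal.ofReal (Real.exp x)) = x := by
  rw [← EReal.exp_coe, EReal.log_exp]

theorem EReal.mul_le_coe_of_le_mul {t r : ℝ} (ht : 0 < t) {x : EReal}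
    (h : x ≤ ((t * r : ℝ) : EReal)) :
    ((t⁻¹ : ℝ) : EReal) * x ≤ r := by
  calc ((t⁻¹ : ℝ) : EReal) * x ≤ ((t⁻¹ : ℝ) : EReal) * ((t * r : ℝ) : EReal) :=
        mul_le_mul_of_nonneg_left h (by exact_mod_cast (inv_pos.2 ht).le)
    _ = r := by
        rw [← EReal.coe_mul, inv_mul_cancel_left₀ ht.ne']

theorem EReal.le_coe_mul_of_inv_mul_le {t r : ℝ} (ht : 0 < t) {x : EReal}
    (h : ((t⁻¹ : ℝ) : EReal) * x ≤ r) : x ≤ ((t * r : ℝ) : EReal) := by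
  have hmul := EReal.mul_le_coe_of_le_mul (inv_pos.2 ht) (r := t * r)
    (h.trans_eq (by rw [inv_mul_cancel_left₀ ht.ne']))
  rwa [_root_.inv_inv, ← mul_assoc, ← EReal.coe_mul, mul_inv_cancel₀ ht.ne', EReal.coe_one,
    one_mul] at hmul

/-- If `Y_n ≥ −nK` a.s. and `P(Y_n ≤ −nε)` decays exponentially for every `ε > 0`, then
`limsup_{λ→0⁺} (1/λ) limsup_n (1/n) log E[exp(−λ Y_n)] ≤ 0`. -/
theorem stmt17
    {Ω : Type*} [MeasurableSpace Ω] (Pr : Measure Ω) [IsProbabilityMeasure Pr]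
    (Y : ℕ → Ω → ℝ) (K : ℝ) (hK : 0 < K)
    (hlb : ∀ n : ℕ, 1 ≤ n → ∀ᵐ ω ∂Pr, -((n : ℝ) * K) ≤ Y n ω)
    (hdev : ∀ ε : ℝ, 0 < ε →
      Filter.limsup
        (fun n : ℕ => (((n : ℝ)⁻¹ : ℝ) : EReal) *
          ENNReal.log (Pr {ω | Y n ω ≤ -((n : ℝ) * ε)})) atTop < 0) :
    Filter.limsup
      (fun l : ℝ => ((l⁻¹ : ℝ) : EReal) *
        Filter.limsup
          (fun n : ℕ => (((n : ℝ)⁻¹ : ℝ) : EReal) *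
            ENNReal.log (∫⁻ ω, ENNReal.ofReal (Real.exp (-(l * Y n ω))) ∂Pr)) atTop)
      (𝓝[>] (0 : ℝ)) ≤ 0 := by
  refine le_of_forall_gt_imp_ge_of_dense fun y hy => ?_
  obtain ⟨η, hη0, hηy⟩ := EReal.lt_iff_exists_real_btwn.1 hy
  refine le_trans ?_ hηy.le
  have hη : 0 < η := by exact_mod_cast hη0
  have hε : 0 < η / 2 := by positivity
  obtain ⟨r, hr, hr0⟩ := EReal.lt_iff_exists_real_btwn.1 (hdev (η / 2) hε)
  have hr0 : r < 0 := by exact_mod_cast hr0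
  have hprob := eventually_lt_of_limsup_lt hr
  have hδ : 0 < -r / K := div_pos (neg_pos.2 hr0) hK
  refine limsup_le_of_le (by isBoundedDefault) ?_
  filter_upwards [Ioo_mem_nhdsGT hδ] with l ⟨hl0, hl⟩
  have hlK : l * K < -r := (lt_div_iff₀ hK).1 hl
  refine EReal.mul_le_coe_of_le_mul hl0 (limsup_le_of_le (by isBoundedDefault) ?_)
  have hlog := (tendsto_natCast_atTop_atTop (R := ℝ)).eventually_ge_atTop
    (Real.log 2 / (l * (η / 2)))
  filter_upwards [hprob, hlog, eventually_ge_atTop 1] with n hn hnlog hn1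
  have hn0 : (0 : ℝ) < n := by exact_mod_cast hn1
  have hlog2 : Real.log 2 ≤ n * (l * (η / 2)) := (div_le_iff₀ (by positivity)).1 hnlog
  refine EReal.mul_le_coe_of_le_mul hn0 ?_
  rw [← ENNReal.log_ofReal_exp]
  refine ENNReal.log_monotone ?_
  have hP : Pr {ω | Y n ω ≤ -((n : ℝ) * (η / 2))} ≤ ENNReal.ofReal (Real.exp (n * r)) := by
    rw [← ENNReal.log_le_log_iff, ENNReal.log_ofReal_exp]
    exact EReal.le_coe_mul_of_inv_mul_le hn0 hn.le
  calc _ ≤ ENNReal.ofReal (Real.exp (n * (l * (η / 2)))) + ENNReal.ofReal (Real.exp (n * (l * K)))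
          * Pr {ω | Y n ω ≤ -((n : ℝ) * (η / 2))} := by
        refine lintegral_le_const_add_mul_measure Pr (fun ω hω => ?_) ?_
        · have hω : -((n : ℝ) * (η / 2)) < Y n ω := not_le.1 hω
          gcongr
          nlinarith
        · filter_upwards [hlb n hn1] with ω hω
          gcongr
          nlinarith
    _ ≤ ENNReal.ofReal (Real.exp (n * (l * (η / 2)))) + ENNReal.ofReal (Real.exp (n * (l * K)))
          * ENNReal.ofReal (Real.exp (n * r)) := by gcongr
    _ ≤ ENNReal.ofReal (Real.exp (n * (l * η))) := by
        rw [← ENNReal.ofReal_mul (Real.exp_pos _).le, ← Real.exp_add,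
          ← ENNReal.ofReal_add (Real.exp_pos _).le (Real.exp_pos _).le]
        refine ENNReal.ofReal_le_ofReal ?_
        have h1 : Real.exp (n * (l * K) + n * r) ≤ Real.exp (n * (l * (η / 2))) := by
          refine Real.exp_le_exp.2 ?_
          have : 0 ≤ n * (l * (η / 2)) := by positivity
          nlinarith
        have h2 : 2 ≤ Real.exp (n * (l * (η / 2))) :=
          (Real.log_le_iff_le_exp two_pos).1 hlog2
        have h3 : Real.exp (n * (l * η)) =
            Real.exp (n * (l * (η / 2))) * Real.exp (n * (l * (η / 2))) := by
          rw [← Real.exp_add]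
          ring_nf
        nlinarith

end
end
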